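/- Let D ≥ 3 be an integer, let ν ∈ ℂ \ ℤ, and let z ∈ (−1,1) be real. For every real h with 0 ≤ h < 1 the series F(h) = Σ_{l=0}^∞ h^l (2l+D−2)·P(z,l,D) / (ν(ν+D−2) − l(l+D−2)) converges absolutely, and lim_{h→1⁻} F(h) = (π/sin(πν)) · P(−z, ν, D). (Abel-summed form of the generalized Dougall formula, valid in every dimension D ≥ 3.) -/

import Mathlib

open Filter

/-- Pochhammer symbol `(a)ₙ = a(a+1)⋯(a+n-1)` for complex `a`. -/
noncomputable def poch (a : ℂ) (n : ℕ) : ℂ := ∏ k ∈ Finset.range n, (a + k)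

/-- Gauss hypergeometric series `₂F₁(a,b;c;x)`. -/
noncomputable def F21 (a b c x : ℂ) : ℂ :=
  ∑' n : ℕ, poch a n * poch b n / (poch c n * n.factorial) * x ^ n

/-- `D`-dimensional Legendre (Gegenbauer) function `P(z, ν, D)`. -/
noncomputable def legP (z ν : ℂ) (D : ℕ) : ℂ :=
  Complex.Gamma (ν + D - 2) / (Complex.Gamma (ν + 1) * Complex.Gamma ((D : ℂ) - 1)) *
    F21 (-ν) (ν + (D : ℂ) - 2) (((D : ℂ) - 1) / 2) ((1 - z) / 2)

open Finset Topology

lemma poch_zero (a : ℂ) : poch a 0 = 1 := by simp [poch]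

lemma poch_succ (a : ℂ) (n : ℕ) : poch a (n + 1) = poch a n * (a + n) :=
  Finset.prod_range_succ _ _

/-- The coefficient `(λ)ₙ / n!` of the series of `(1 - y) ^ (-λ)`, for `λ = (k + 1) / 2`. -/
noncomputable def halfBinom (k n : ℕ) : ℝ := ∏ i ∈ range n, (((k : ℝ) + 1) / 2 + i) / (i + 1)

lemma halfBinom_zero (k : ℕ) : halfBinom k 0 = 1 := by simp [halfBinom]

lemma halfBinom_succ (k n : ℕ) :
    halfBinom k (n + 1) = halfBinom k n * ((((k : ℝ) + 1) / 2 + n) / (n + 1)) :=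
  Finset.prod_range_succ _ _

lemma halfBinom_pos (k n : ℕ) : 0 < halfBinom k n :=
  Finset.prod_pos fun _ _ => by positivity

lemma choose_eq_halfBinom (k n : ℕ) :
    Ring.choose (((k : ℂ) + 1) / 2 + n - 1) n = halfBinom k n := by
  rw [← Ring.multichoose_eq]
  have key : ∀ n : ℕ, (ascPochhammer ℂ n).eval (((k : ℂ) + 1) / 2) =
      (n.factorial : ℂ) * halfBinom k n := by
    intro n
    induction n with
    | zero => simp [halfBinom_zero]
    | succ n ih =>
      have : (n : ℂ) + 1 ≠ 0 := by exact_mod_cast n.succ_ne_zero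
      rw [ascPochhammer_succ_eval, ih, halfBinom_succ, Nat.factorial_succ]
      push_cast
      field_simp
  have h := Ring.factorial_nsmul_multichoose_eq_ascPochhammer (((k : ℂ) + 1) / 2) n
  rw [Polynomial.ascPochhammer_smeval_eq_eval, key, nsmul_eq_mul] at h
  exact mul_left_cancel₀ (by exact_mod_cast n.factorial_ne_zero) h

lemma hasSum_halfBinom (k : ℕ) {y : ℂ} (hy : ‖y‖ < 1) :
    HasSum (fun n => (halfBinom k n : ℂ) * y ^ n) (1 / (1 - y) ^ (((k : ℂ) + 1) / 2)) := by
  have h := (Complex.one_div_one_sub_cpow_hasFPowerSeriesOnBall_zero (((k : ℂ) + 1) / 2)).hasSum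
    (y := y) (by simpa [enorm_eq_nnnorm, ← NNReal.coe_lt_coe] using hy)
  simpa [choose_eq_halfBinom, mul_comm] using h

lemma summable_halfBinom (k : ℕ) {r : ℝ} (hr0 : 0 ≤ r) (hr : r < 1) :
    Summable fun n => halfBinom k n * r ^ n := by
  have h := (hasSum_halfBinom k (y := (r : ℂ)) (by simpa [abs_of_nonneg hr0] using hr)).summable
  exact_mod_cast h

lemma hasSum_pow_mul_choose {𝕜 : Type*} [RCLike 𝕜] (k n : ℕ) {y : 𝕜} (hy : ‖y‖ < 1) :
    HasSum (fun l : ℕ => y ^ l * ((l + n + k).choose (k + 2 * n) : 𝕜))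
      (y ^ n / (1 - y) ^ (k + 2 * n + 1)) := by
  have h := (hasSum_choose_mul_geometric_of_norm_lt_one (k + 2 * n) hy).mul_left (y ^ n)
  have h2 : ∑ i ∈ range n, y ^ i * ((i + n + k).choose (k + 2 * n) : 𝕜) = 0 :=
    Finset.sum_eq_zero fun i hi => by
      rw [Nat.choose_eq_zero_of_lt (by have := Finset.mem_range.1 hi; omega)]; simp
  rw [← add_zero (y ^ n / _), ← h2]
  refine (hasSum_nat_add_iff n).1 ?_
  rw [← mul_one_div]
  refine h.congr_fun fun j => ?_
  rw [show j + n + n + k = j + (k + 2 * n) by omega]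
  ring

/-- Coefficient of `vⁿ` in the Gegenbauer polynomial `C_l^λ(1 - 2v)`, for `λ = (k + 1) / 2`. -/
noncomputable def gegCoeff (k l n : ℕ) : ℂ :=
  (-4) ^ n * halfBinom k n * ((l + n + k).choose (k + 2 * n) : ℂ)

lemma gegCoeff_eq_zero (k : ℕ) {l n : ℕ} (h : l < n) : gegCoeff k l n = 0 := by
  rw [gegCoeff, Nat.choose_eq_zero_of_lt (by omega)]; simp

lemma choose_succ_mul (k l n : ℕ) :
    ((l + n + k).choose (k + 2 * n + 1) : ℂ) * (k + 2 * n + 1) =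
      (l + n + k).choose (k + 2 * n) * (l - n) := by
  rcases lt_or_ge l n with h | h
  · rw [Nat.choose_eq_zero_of_lt (by omega), Nat.choose_eq_zero_of_lt (by omega)]; simp
  · have := Nat.choose_succ_right_eq (l + n + k) (k + 2 * n)
    rw [show l + n + k - (k + 2 * n) = l - n by omega] at this
    have := congrArg (Nat.cast : ℕ → ℂ) this
    push_cast [Nat.cast_sub h] at this
    exact this

lemma gegCoeff_succ (k l n : ℕ) :
    ((n : ℂ) + 1) * (n + (k + 2) / 2) * gegCoeff k l (n + 1) =
      (n - l) * (n + l + (k + 1)) * gegCoeff k l n := by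
  have h1 : ((l + (n + 1) + k).choose (k + 2 * (n + 1)) : ℂ) * ((k + 2 * n + 1) * (k + 2 * n + 2)) =
      ((l + n + k).choose (k + 2 * n) : ℂ) * ((l + n + k + 1) * (l - n)) := by
    have a1 := Nat.add_one_mul_choose_eq (l + n + k) (k + 2 * n + 1)
    have a2 := choose_succ_mul k l n
    have a1 := congrArg (Nat.cast : ℕ → ℂ) a1
    push_cast at a1
    rw [show l + (n + 1) + k = l + n + k + 1 by omega,
      show k + 2 * (n + 1) = k + 2 * n + 1 + 1 by omega]
    linear_combination (-(k + 2 * n + 1) : ℂ) * a1 + (l + n + k + 1 : ℂ) * a2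
  have h2 : (halfBinom k (n + 1) : ℂ) * (n + 1) = halfBinom k n * (((k : ℂ) + 1) / 2 + n) := by
    have hn : (n : ℂ) + 1 ≠ 0 := by exact_mod_cast n.succ_ne_zero
    rw [halfBinom_succ]
    push_cast
    field_simp
  rw [gegCoeff, gegCoeff, pow_succ]
  linear_combination (-(-4 : ℂ) ^ n * halfBinom k n) * h1 + ((n + (k + 2) / 2) * (-4 : ℂ) ^ n *
    (-4) * ((l + (n + 1) + k).choose (k + 2 * (n + 1)) : ℂ)) * h2

lemma hasSum_pow_mul_gegCoeff (k n : ℕ) {y : ℂ} (hy : ‖y‖ < 1) :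
    HasSum (fun l : ℕ => y ^ l * gegCoeff k l n)
      (1 / (1 - y) ^ (k + 1) * (halfBinom k n * (-4 * y / (1 - y) ^ 2) ^ n)) := by
  have h := (hasSum_pow_mul_choose k n hy).mul_left ((-4) ^ n * (halfBinom k n : ℂ))
  have e : 1 / (1 - y) ^ (k + 1) * (halfBinom k n * (-4 * y / (1 - y) ^ 2) ^ n) =
      (-4) ^ n * (halfBinom k n : ℂ) * (y ^ n / (1 - y) ^ (k + 2 * n + 1)) := by
    rw [div_pow, mul_pow, ← pow_mul, show k + 2 * n + 1 = k + 1 + 2 * n by omega, pow_add]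
    generalize 1 - y = w
    ring
  rw [e]
  exact h.congr_fun (fun l => by rw [gegCoeff]; ring)

/-- The Gegenbauer polynomial `C_l^λ(1 - 2v)`, for `λ = (k + 1) / 2`. -/
noncomputable def geg (k l : ℕ) (v : ℂ) : ℂ := ∑ n ∈ range (l + 1), gegCoeff k l n * v ^ n

lemma hasSum_geg (k l : ℕ) (v : ℂ) : HasSum (fun n => gegCoeff k l n * v ^ n) (geg k l v) :=
  hasSum_sum_of_ne_finset_zero fun n hn => by
    rw [gegCoeff_eq_zero k (by simpa using hn), zero_mul]

/-- The generating function of the Gegenbauer polynomials. -/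
noncomputable def gegGen (k : ℕ) (v x : ℂ) : ℂ :=
  1 / (1 - x) ^ (k + 1) * (1 / (1 - (-4 * x / (1 - x) ^ 2) * v) ^ (((k : ℂ) + 1) / 2))

lemma hasSum_gegGen_coeff (k : ℕ) {v x : ℂ} (h : ‖-4 * x / (1 - x) ^ 2 * v‖ < 1) :
    HasSum (fun n => 1 / (1 - x) ^ (k + 1) * (halfBinom k n * (-4 * x / (1 - x) ^ 2) ^ n) * v ^ n)
      (gegGen k v x) := by
  refine ((hasSum_halfBinom k h).mul_left (1 / (1 - x) ^ (k + 1))).congr_fun fun n => ?_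
  rw [mul_pow]; ring

lemma hasSum_gegGen_of_small (k : ℕ) {v x : ℂ} (hv : ‖v‖ ≤ 1) (hx : ‖x‖ < 1 / 10) :
    HasSum (fun l => x ^ l * geg k l v) (gegGen k v x) := by
  set f : ℕ × ℕ → ℂ := fun p => x ^ p.2 * gegCoeff k p.2 p.1 * v ^ p.1 with hf
  have hx1 : ‖x‖ < 1 := by linarith
  have hxn : ‖‖x‖‖ < 1 := by simpa using hx1
  have hnorm : ∀ n, HasSum (fun l => ‖f (n, l)‖)
      (1 / (1 - ‖x‖) ^ (k + 1) * (halfBinom k n * ((4 * ‖x‖ / (1 - ‖x‖) ^ 2) * ‖v‖) ^ n)) := by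
    intro n
    have h := (hasSum_pow_mul_choose k n hxn).mul_left (4 ^ n * halfBinom k n * ‖v‖ ^ n)
    have e : 1 / (1 - ‖x‖) ^ (k + 1) * (halfBinom k n * ((4 * ‖x‖ / (1 - ‖x‖) ^ 2) * ‖v‖) ^ n) =
        4 ^ n * halfBinom k n * ‖v‖ ^ n * (‖x‖ ^ n / (1 - ‖x‖) ^ (k + 2 * n + 1)) := by
      rw [mul_pow, div_pow, mul_pow, ← pow_mul, show k + 2 * n + 1 = k + 1 + 2 * n by omega,
        pow_add]
      generalize 1 - ‖x‖ = w
      ring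
    rw [e]
    refine h.congr_fun fun l => ?_
    simp [hf, gegCoeff, abs_of_pos (halfBinom_pos k n)]
    ring
  have hsmall : 4 * ‖x‖ / (1 - ‖x‖) ^ 2 * ‖v‖ < 1 := by
    have h0 := norm_nonneg x
    have : 4 * ‖x‖ / (1 - ‖x‖) ^ 2 < 1 := by
      rw [div_lt_one (by nlinarith)]; nlinarith
    calc _ ≤ 4 * ‖x‖ / (1 - ‖x‖) ^ 2 * 1 := by gcongr
      _ < 1 := by simpa using this
  have hsum : Summable f := by
    refine Summable.of_norm ((summable_prod_of_nonneg fun _ => norm_nonneg _).2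
      ⟨fun n => (hnorm n).summable, ?_⟩)
    simp_rw [fun n => (hnorm n).tsum_eq]
    exact (summable_halfBinom k (by positivity) hsmall).mul_left _
  have hsmall' : ‖-4 * x / (1 - x) ^ 2 * v‖ < 1 := by
    refine lt_of_le_of_lt ?_ hsmall
    have : 1 - ‖x‖ ≤ ‖1 - x‖ := by simpa using norm_sub_norm_le (1 : ℂ) x
    have h1 : 0 < 1 - ‖x‖ := by linarith
    simp only [norm_mul, norm_div, norm_pow, norm_neg, RCLike.norm_ofNat]
    gcongr
  have h1 := hsum.hasSum.prod_fiberwise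
    (fun n => (hasSum_pow_mul_gegCoeff k n hx1).mul_right (v ^ n))
  have h2 : HasSum (f ∘ Prod.swap) (gegGen k v x) := by
    rw [← h1.unique (hasSum_gegGen_coeff k hsmall')]
    exact (Equiv.prodComm ℕ ℕ).hasSum_iff.2 hsum.hasSum
  refine h2.prod_fiberwise fun l => ?_
  exact ((hasSum_geg k l v).mul_left (x ^ l)).congr_fun fun n => by simp [hf, mul_assoc]

lemma gegGen_ofReal (k : ℕ) {v x : ℝ} (hv : v ∈ Set.Ioo (0 : ℝ) 1) (hx : x < 1) :
    gegGen k v x = ((1 / ((1 - x) ^ 2 + 4 * x * v) ^ (((k : ℝ) + 1) / 2) : ℝ) : ℂ) := by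
  have ha : 0 < 1 - x := by linarith
  have hW : 0 < (1 - x) ^ 2 + 4 * x * v := by
    nlinarith [sq_nonneg (x - (1 - 2 * v)), mul_pos hv.1 (sub_pos.2 hv.2)]
  have e : (1 : ℂ) - -4 * x / (1 - x) ^ 2 * v =
      ((((1 - x) ^ 2 + 4 * x * v) / (1 - x) ^ 2 : ℝ) : ℂ) := by
    have : (1 : ℂ) - x ≠ 0 := by exact_mod_cast ha.ne'
    push_cast
    field_simp
    ring
  have e2 : ((1 - x) ^ 2 : ℝ) ^ (((k : ℝ) + 1) / 2) = (1 - x) ^ (k + 1) := by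
    rw [← Real.rpow_natCast, ← Real.rpow_mul ha.le, ← Real.rpow_natCast]
    congr 1
    push_cast
    ring
  rw [gegGen, e, show ((k : ℂ) + 1) / 2 = (((k : ℝ) + 1) / 2 : ℝ) by push_cast; ring,
    ← Complex.ofReal_cpow (by positivity), Real.div_rpow hW.le (by positivity), e2]
  have := Real.rpow_pos_of_pos hW (((k : ℝ) + 1) / 2)
  norm_cast
  field_simp

lemma hasFPowerSeriesAt_gegGen (k : ℕ) {v : ℂ} (hv : ‖v‖ ≤ 1) :
    HasFPowerSeriesAt (gegGen k v) (.ofScalars ℂ fun l => geg k l v) 0 := by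
  rw [hasFPowerSeriesAt_iff]
  filter_upwards [Metric.ball_mem_nhds (0 : ℂ) (show (0 : ℝ) < 1 / 10 by norm_num)] with x hx
  simpa using hasSum_gegGen_of_small k hv (x := x) (by simpa using hx)

lemma hasFPowerSeriesAt_gegGen_neg (k : ℕ) {v : ℂ} (hv : ‖v‖ ≤ 1) :
    HasFPowerSeriesAt (fun x => gegGen k v (-x))
      (.ofScalars ℂ fun l => (-1) ^ l * geg k l v) 0 := by
  rw [hasFPowerSeriesAt_iff]
  filter_upwards [Metric.ball_mem_nhds (0 : ℂ) (show (0 : ℝ) < 1 / 10 by norm_num)] with x hx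
  have := hasSum_gegGen_of_small k hv (x := -x) (by simpa using hx)
  simp only [zero_add]
  refine this.congr_fun fun l => ?_
  simp only [FormalMultilinearSeries.coeff_ofScalars, smul_eq_mul]
  rw [neg_pow]
  ring

lemma norm_ofReal_le_one {v : ℝ} (hv : v ∈ Set.Ioo (0 : ℝ) 1) : ‖(v : ℂ)‖ ≤ 1 := by
  simpa [abs_of_pos hv.1] using hv.2.le

lemma geg_one_sub (k l : ℕ) {v : ℝ} (hv : v ∈ Set.Ioo (0 : ℝ) 1) :
    geg k l (1 - v : ℝ) = (-1) ^ l * geg k l v := by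
  have hv' : 1 - v ∈ Set.Ioo (0 : ℝ) 1 := ⟨by linarith [hv.2], by linarith [hv.1]⟩
  have h1 := hasFPowerSeriesAt_gegGen k (norm_ofReal_le_one hv')
  have h2 := hasFPowerSeriesAt_gegGen_neg k (norm_ofReal_le_one hv)
  have hev : ∀ᶠ x : ℝ in 𝓝[≠] 0, gegGen k (1 - v : ℝ) x = gegGen k v (-x) := by
    filter_upwards [nhdsWithin_le_nhds (Ioo_mem_nhds (show (-1 : ℝ) < 0 by norm_num) one_pos)]
      with x hx
    rw [gegGen_ofReal k hv' hx.2, ← Complex.ofReal_neg, gegGen_ofReal k hv (by linarith [hx.1])]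
    congr 3
    ring
  have hfreq : ∃ᶠ x : ℂ in 𝓝[≠] 0, gegGen k (1 - v : ℝ) x = gegGen k v (-x) := by
    have ht : Tendsto (fun x : ℝ => (x : ℂ)) (𝓝[≠] 0) (𝓝[≠] 0) := by
      refine tendsto_nhdsWithin_iff.2 ⟨?_, ?_⟩
      · exact (Complex.continuous_ofReal.tendsto' 0 0 (by simp)).mono_left nhdsWithin_le_nhds
      · filter_upwards [self_mem_nhdsWithin] with x hx
        simpa using hx
    exact ht.frequently hev.frequently
  have heq := (h1.analyticAt.frequently_eq_iff_eventually_eq h2.analyticAt).1 hfreq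
  have := h1.eq_formalMultilinearSeries_of_eventually h2 heq
  simpa using congrArg (fun p => FormalMultilinearSeries.coeff p l) this

lemma gegGen_base_mem_slitPlane {v : ℝ} (hv : v ∈ Set.Ioo (0 : ℝ) 1) {x : ℂ} (hx : ‖x‖ < 1) :
    1 - -4 * x / (1 - x) ^ 2 * v ∈ Complex.slitPlane := by
  by_contra hcon
  simp only [Complex.mem_slitPlane_iff, not_or, not_lt, not_not] at hcon
  set u := 1 - -4 * x / (1 - x) ^ 2 * v with hu
  have hx1 : 1 - x ≠ 0 := by
    intro h
    rw [← sub_eq_zero.1 h] at hx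
    simp at hx
  obtain ⟨c, hc, huc⟩ : ∃ c : ℝ, 1 ≤ c ∧ u = ((1 - c : ℝ) : ℂ) :=
    ⟨1 - u.re, by linarith [hcon.1], by apply Complex.ext <;> simp [hcon.2]⟩
  have hq : (c : ℂ) * (1 - x) ^ 2 + 4 * x * v = 0 := by
    rw [hu] at huc
    push_cast at huc
    field_simp at huc
    linear_combination huc
  have hn : x.re ^ 2 + x.im ^ 2 < 1 := by
    have := Complex.sq_norm x
    rw [Complex.normSq_apply] at this
    nlinarith [norm_nonneg x]
  have hre := congrArg Complex.re hq
  have him := congrArg Complex.im hq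
  simp [pow_two] at hre him
  obtain ⟨hv0, hv1⟩ := hv
  generalize x.re = a at *
  generalize x.im = b at *
  have him' : b * (2 * c * a - (2 * c - 4 * v)) = 0 := by linarith
  rcases mul_eq_zero.1 him' with hb | hb
  · subst hb
    rcases le_or_gt 0 a with h | h
    · have h1 : a < 1 := by nlinarith
      nlinarith [mul_pos (show 0 < c by linarith) (pow_pos (sub_pos.2 h1) 2), mul_nonneg h hv0.le]
    · nlinarith [mul_pos (neg_pos.2 h) (show 0 < c - v by linarith),
        mul_nonneg (show 0 ≤ c by linarith) (sq_nonneg (a + 1))]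
  · nlinarith [mul_pos (show 0 < c by linarith) (sub_pos.2 hn)]

lemma differentiableOn_gegGen (k : ℕ) {v : ℝ} (hv : v ∈ Set.Ioo (0 : ℝ) 1) :
    DifferentiableOn ℂ (gegGen k v) (Metric.ball 0 1) := by
  intro x hx
  have hx' : ‖x‖ < 1 := by simpa using hx
  have hx1 : 1 - x ≠ 0 := by
    intro h
    rw [← sub_eq_zero.1 h] at hx'
    simp at hx'
  have hs := gegGen_base_mem_slitPlane hv hx'
  have hne : (1 - -4 * x / (1 - x) ^ 2 * v : ℂ) ^ (((k : ℂ) + 1) / 2) ≠ 0 :=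
    fun h => Complex.slitPlane_ne_zero hs ((Complex.cpow_eq_zero_iff _ _).1 h).1
  have d1 : DifferentiableAt ℂ (fun x : ℂ => 1 - -4 * x / (1 - x) ^ 2 * (v : ℂ)) x := by
    have : (1 - x) ^ 2 ≠ 0 := pow_ne_zero _ hx1
    fun_prop (disch := assumption)
  have d2 : DifferentiableAt ℂ
      (fun x : ℂ => (1 - -4 * x / (1 - x) ^ 2 * (v : ℂ)) ^ (((k : ℂ) + 1) / 2)) x :=
    d1.cpow_const hs
  have d3 : DifferentiableAt ℂ (fun x : ℂ => (1 - x) ^ (k + 1)) x := by fun_prop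
  unfold gegGen
  exact (((differentiableAt_const 1).div d3 (pow_ne_zero _ hx1)).mul
    ((differentiableAt_const 1).div d2 hne)).differentiableWithinAt

/-- The generating function identity on the whole unit disc. -/
lemma hasSum_gegGen (k : ℕ) {v : ℝ} (hv : v ∈ Set.Ioo (0 : ℝ) 1) {x : ℂ} (hx : ‖x‖ < 1) :
    HasSum (fun l => x ^ l * geg k l v) (gegGen k v x) := by
  obtain ⟨r, hxr, hr⟩ := exists_between hx
  have hr0 : 0 < r := (norm_nonneg x).trans_lt hxr
  lift r to NNReal using hr0.le
  have hd : DifferentiableOn ℂ (gegGen k v) (Metric.closedBall 0 r) :=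
    (differentiableOn_gegGen k hv).mono (Metric.closedBall_subset_ball hr)
  have h1 := hd.hasFPowerSeriesOnBall (by exact_mod_cast hr0)
  rw [h1.hasFPowerSeriesAt.eq_formalMultilinearSeries
    (hasFPowerSeriesAt_gegGen k (norm_ofReal_le_one hv))] at h1
  have := h1.hasSum (y := x) (by simpa [enorm_eq_nnnorm, ← NNReal.coe_lt_coe] using hxr)
  simpa [mul_comm] using this

lemma tendsto_inv_natCast_add (s : ℂ) :
    Tendsto (fun l : ℕ => ((l : ℂ) + s)⁻¹) atTop (𝓝 0) := by
  refine tendsto_inv₀_cobounded.comp (tendsto_norm_atTop_iff_cobounded.1 ?_)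
  refine tendsto_atTop_mono (fun l => ?_)
    (tendsto_atTop_add_const_right _ (-‖s‖) tendsto_natCast_atTop_atTop)
  have := norm_sub_le ((l : ℂ) + s) s
  simp at this
  linarith

lemma summable_div_natCast_add {a : ℕ → ℂ} (ha : Summable a) (s : ℂ) :
    Summable fun l : ℕ => a l / (l + s) := by
  refine summable_of_isBigO_nat ha.norm ?_
  have ht := tendsto_inv_natCast_add s
  have := (Asymptotics.isBigO_refl a atTop).norm_right.mul (ht.isBigO_one ℝ)
  simpa [div_eq_mul_inv] using this

/-- A series `∑ dₗ hˡ / (l + s)` is a Mellin transform of `∑ dₗ xˡ`, and is bounded accordingly. -/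
lemma norm_tsum_div_le {s : ℂ} {N : ℕ} (hN : 1 ≤ N + s.re) {d : ℕ → ℂ} (hd : ∀ l < N, d l = 0)
    {h : ℝ} (h0 : 0 ≤ h) (h1 : h ≤ 1) (hs : Summable fun l => ‖d l‖ * h ^ l) {M : ℝ} (hM0 : 0 ≤ M)
    (hM : ∀ x ∈ Set.Icc 0 h, ‖∑' l, (x : ℂ) ^ l * d l‖ ≤ M * x ^ N) :
    ‖∑' l : ℕ, (h : ℂ) ^ l * d l / (l + s)‖ ≤ M := by
  have hMh : 0 ≤ M * h ^ N := by positivity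
  have hre : ∀ l, N ≤ l → 0 ≤ ((l : ℂ) + s - 1).re := by
    intro l hl
    have : (N : ℝ) ≤ l := by exact_mod_cast hl
    simp
    linarith
  set F : ℕ → ℝ → ℂ := fun l u => d l * h ^ l * (u : ℂ) ^ ((l : ℂ) + s - 1) with hF
  have hint : ∀ l, ∫ u in (0 : ℝ)..1, F l u = (h : ℂ) ^ l * d l / (l + s) := by
    intro l
    rcases lt_or_ge l N with hl | hl
    · simp [hF, hd l hl]
    · have hr := hre l hl
      have hne : (l : ℂ) + s ≠ 0 := by
        intro h
        rw [h] at hr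
        simp at hr
        linarith
      simp only [hF]
      rw [intervalIntegral.integral_const_mul, integral_cpow (Or.inl (by linarith))]
      simp [Complex.zero_cpow hne]
      ring
  have hpt : ∀ u ∈ Set.Ioc (0 : ℝ) 1,
      HasSum (fun l => F l u) ((u : ℂ) ^ (s - 1) * ∑' l, ((u * h : ℝ) : ℂ) ^ l * d l) := by
    intro u hu
    have hu0 : (u : ℂ) ≠ 0 := by exact_mod_cast hu.1.ne'
    have hsum : Summable fun l => ((u * h : ℝ) : ℂ) ^ l * d l := by
      refine Summable.of_norm_bounded hs fun l => ?_
      rw [norm_mul, norm_pow, Complex.norm_real, Real.norm_of_nonneg (mul_nonneg hu.1.le h0),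
        mul_comm]
      gcongr
      · exact mul_nonneg hu.1.le h0
      · exact mul_le_of_le_one_left h0 hu.2
    refine (hsum.hasSum.mul_left _).congr_fun fun l => ?_
    simp only [hF]
    rw [show (l : ℂ) + s - 1 = s - 1 + l by ring, Complex.cpow_add _ _ hu0, Complex.cpow_natCast]
    push_cast
    ring
  have hsum := intervalIntegral.hasSum_integral_of_dominated_convergence (a := 0) (b := 1)
    (F := F) (μ := MeasureTheory.volume) (fun l _ => ‖d l‖ * h ^ l)
    (fun l => by
      refine ContinuousOn.aestronglyMeasurable ?_ measurableSet_uIoc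
      intro u hu
      rw [Set.uIoc_of_le zero_le_one] at hu
      refine (continuousAt_const.mul ?_).continuousWithinAt
      exact (Complex.continuousAt_ofReal_cpow_const _ _ (Or.inr hu.1.ne')))
    (fun l => MeasureTheory.ae_of_all _ fun u hu => by
      rw [Set.uIoc_of_le zero_le_one] at hu
      rcases lt_or_ge l N with hl | hl
      · simp [hF, hd l hl]
      · simp only [hF]
        rw [norm_mul, norm_mul, norm_pow, Complex.norm_real, Real.norm_of_nonneg h0,
          Complex.norm_cpow_eq_rpow_re_of_pos hu.1]
        exact mul_le_of_le_one_right (by positivity)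
          (Real.rpow_le_one hu.1.le hu.2 (hre l hl)))
    (MeasureTheory.ae_of_all _ fun u hu => hs) (by simp)
    (MeasureTheory.ae_of_all _ fun u hu => hpt u (by rwa [Set.uIoc_of_le zero_le_one] at hu))
  simp_rw [hint] at hsum
  rw [hsum.tsum_eq]
  have hle := intervalIntegral.norm_integral_le_of_norm_le_const (a := 0) (b := 1) (C := M * h ^ N)
    (f := fun u : ℝ => (u : ℂ) ^ (s - 1) * ∑' l, ((u * h : ℝ) : ℂ) ^ l * d l) (by
      intro u hu
      rw [Set.uIoc_of_le zero_le_one] at hu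
      rw [norm_mul, Complex.norm_cpow_eq_rpow_re_of_pos hu.1]
      calc u ^ (s - 1).re * ‖∑' l, ((u * h : ℝ) : ℂ) ^ l * d l‖
          ≤ u ^ (s - 1).re * (M * (u * h) ^ N) := by
            have := Real.rpow_nonneg hu.1.le (s - 1).re
            gcongr
            exact hM _ ⟨mul_nonneg hu.1.le h0, mul_le_of_le_one_left h0 hu.2⟩
        _ = u ^ ((s - 1).re + N) * (M * h ^ N) := by
            rw [Real.rpow_add hu.1, Real.rpow_natCast]
            ring
        _ ≤ M * h ^ N := by
            refine mul_le_of_le_one_left hMh (Real.rpow_le_one hu.1.le hu.2 ?_)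
            simp
            linarith)
  refine hle.trans ?_
  simpa using mul_le_of_le_one_right hM0 (pow_le_one₀ h0 h1)

lemma norm_neg_ofReal_lt_one {h : ℝ} (h0 : 0 ≤ h) (h1 : h < 1) : ‖-(h : ℂ)‖ < 1 := by
  simpa [abs_of_nonneg h0] using h1

lemma summable_pow_mul_geg (k : ℕ) {v : ℝ} (hv : v ∈ Set.Ioo (0 : ℝ) 1) {h : ℝ} (h0 : 0 ≤ h)
    (h1 : h < 1) : Summable fun l : ℕ => (-(h : ℂ)) ^ l * geg k l v :=
  (hasSum_gegGen k hv (norm_neg_ofReal_lt_one h0 h1)).summable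

lemma summable_pow_mul_gegCoeff (k n : ℕ) {h : ℝ} (h0 : 0 ≤ h) (h1 : h < 1) :
    Summable fun l : ℕ => (-(h : ℂ)) ^ l * gegCoeff k l n :=
  (hasSum_pow_mul_gegCoeff k n (norm_neg_ofReal_lt_one h0 h1)).summable

/-- The difference between `C_l^λ(2v - 1)` and the first `K` terms of its expansion in `v`. -/
noncomputable def gegTail (k K : ℕ) (v : ℂ) (l : ℕ) : ℂ :=
  (-1) ^ l * (geg k l v - ∑ n ∈ range K, gegCoeff k l n * v ^ n)

lemma gegTail_eq_zero (k : ℕ) {K l : ℕ} (v : ℂ) (h : l < K) : gegTail k K v l = 0 := by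
  rw [gegTail, geg, ← Finset.sum_subset (Finset.range_subset_range.2 (Nat.succ_le_of_lt h))]
  · simp
  · intro n _ hn
    rw [gegCoeff_eq_zero k (by simpa using hn), zero_mul]

lemma pow_mul_gegTail (k K : ℕ) (v x : ℂ) (l : ℕ) :
    x ^ l * gegTail k K v l =
      (-x) ^ l * geg k l v - ∑ n ∈ range K, (-x) ^ l * gegCoeff k l n * v ^ n := by
  rw [gegTail, neg_pow x, mul_sub, mul_sub, Finset.mul_sum, Finset.mul_sum]
  congr 1
  · ring
  · exact Finset.sum_congr rfl fun n _ => by ring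

lemma summable_pow_mul_gegTail (k K : ℕ) {v : ℝ} (hv : v ∈ Set.Ioo (0 : ℝ) 1) {h : ℝ}
    (h0 : 0 ≤ h) (h1 : h < 1) : Summable fun l => (h : ℂ) ^ l * gegTail k K v l := by
  simp_rw [pow_mul_gegTail]
  exact (summable_pow_mul_geg k hv h0 h1).sub
    (summable_sum fun n _ => (summable_pow_mul_gegCoeff k n h0 h1).mul_right _)

lemma norm_tsum_gegTail_le (k : ℕ) {N K : ℕ} (hK : N ≤ K) {v : ℝ} (hv : v ∈ Set.Ioo (0 : ℝ) 1)
    {x : ℝ} (h0 : 0 ≤ x) (h1 : x < 1) :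
    ‖∑' l, (x : ℂ) ^ l * gegTail k K v l‖ ≤
      (4 ^ N * ∑' n, halfBinom k (n + K) * v ^ (n + K)) * x ^ N := by
  have hx := norm_neg_ofReal_lt_one h0 h1
  set w : ℝ := 4 * x / (1 + x) ^ 2 with hw
  have hw0 : 0 ≤ w := by positivity
  have hw1 : w ≤ 1 := by
    rw [hw, div_le_one (by positivity)]
    nlinarith [sq_nonneg (1 - x)]
  have hwx : w ≤ 4 * x := div_le_self (by positivity) (by nlinarith)
  have hwc : -4 * (-(x : ℂ)) / (1 - -(x : ℂ)) ^ 2 = w := by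
    rw [hw]
    push_cast
    ring
  have hsmall : ‖-4 * (-(x : ℂ)) / (1 - -(x : ℂ)) ^ 2 * v‖ < 1 := by
    rw [hwc, norm_mul, Complex.norm_real, Complex.norm_real, Real.norm_of_nonneg hw0,
      Real.norm_of_nonneg hv.1.le]
    calc w * v ≤ 1 * v := by gcongr; exact hv.1.le
      _ < 1 := by simpa using hv.2
  have e : ∑' l, (x : ℂ) ^ l * gegTail k K v l = gegGen k v (-x) - ∑ n ∈ range K,
      1 / (1 - -(x : ℂ)) ^ (k + 1) *
        (halfBinom k n * (-4 * (-(x : ℂ)) / (1 - -(x : ℂ)) ^ 2) ^ n) * (v : ℂ) ^ n := by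
    simp_rw [pow_mul_gegTail]
    exact ((hasSum_gegGen k hv hx).sub (hasSum_sum fun n _ =>
      (hasSum_pow_mul_gegCoeff k n hx).mul_right ((v : ℂ) ^ n))).tsum_eq
  rw [e]
  have htail := (hasSum_nat_add_iff' K).2 (hasSum_gegGen_coeff k hsmall)
  have hmaj := ((summable_nat_add_iff K).2 (summable_halfBinom k hv.1.le hv.2)).hasSum.mul_left
    ((4 * x) ^ N)
  have := htail.norm_le_of_bounded hmaj fun n => by
    rw [hwc, show (1 : ℂ) - -(x : ℂ) = ((1 + x : ℝ) : ℂ) by push_cast; ring]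
    simp only [norm_mul, norm_div, norm_pow, Complex.norm_real, norm_one]
    rw [Real.norm_of_nonneg (halfBinom_pos _ _).le, Real.norm_of_nonneg hw0,
      Real.norm_of_nonneg hv.1.le, Real.norm_of_nonneg (by linarith : 0 ≤ 1 + x)]
    have a1 : 1 / (1 + x) ^ (k + 1) ≤ 1 := by
      rw [div_le_one (by positivity)]
      exact one_le_pow₀ (by linarith)
    have a2 : w ^ (n + K) ≤ (4 * x) ^ N :=
      (pow_le_pow_of_le_one hw0 hw1 (by omega)).trans (pow_le_pow_left₀ hw0 hwx N)
    have hp := (halfBinom_pos k (n + K)).le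
    have hvp : 0 ≤ v ^ (n + K) := pow_nonneg hv.1.le _
    calc 1 / (1 + x) ^ (k + 1) * (halfBinom k (n + K) * w ^ (n + K)) * v ^ (n + K)
        ≤ 1 * (halfBinom k (n + K) * (4 * x) ^ N) * v ^ (n + K) := by gcongr
      _ = _ := by ring
  refine this.trans (le_of_eq ?_)
  rw [mul_pow]
  ring

/-- Termwise expansion in powers of `v` of `∑ (-h)ˡ C_l^λ(1 - 2v) / (l + s)`. -/
lemma tendsto_sum_gegCoeff_div (k : ℕ) {v : ℝ} (hv : v ∈ Set.Ioo (0 : ℝ) 1) {h : ℝ} (h0 : 0 ≤ h)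
    (h1 : h < 1) (s : ℂ) :
    Tendsto (fun K => ∑ n ∈ range K,
        (∑' l : ℕ, (-(h : ℂ)) ^ l * gegCoeff k l n / (l + s)) * (v : ℂ) ^ n) atTop
      (𝓝 (∑' l : ℕ, (-(h : ℂ)) ^ l * geg k l v / (l + s))) := by
  obtain ⟨N, hN⟩ := exists_nat_ge (1 - s.re)
  have hτ : Tendsto (fun K => 4 ^ N * ∑' n, halfBinom k (n + K) * v ^ (n + K)) atTop (𝓝 0) := by
    simpa using (tendsto_sum_nat_add fun n => halfBinom k n * v ^ n).const_mul ((4 : ℝ) ^ N)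
  rw [tendsto_iff_norm_sub_tendsto_zero]
  refine squeeze_zero' (Eventually.of_forall fun _ => norm_nonneg _) ?_ hτ
  filter_upwards [eventually_ge_atTop N] with K hK
  have e : ∑' l : ℕ, (h : ℂ) ^ l * gegTail k K v l / (l + s) =
      ∑' l : ℕ, (-(h : ℂ)) ^ l * geg k l v / (l + s) - ∑ n ∈ range K,
        (∑' l : ℕ, (-(h : ℂ)) ^ l * gegCoeff k l n / (l + s)) * (v : ℂ) ^ n := by
    refine HasSum.tsum_eq ?_
    refine ((summable_div_natCast_add (summable_pow_mul_geg k hv h0 h1) s).hasSum.sub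
      (hasSum_sum fun n _ => (summable_div_natCast_add
        (summable_pow_mul_gegCoeff k n h0 h1) s).hasSum.mul_right ((v : ℂ) ^ n))).congr_fun
      fun l => ?_
    rw [pow_mul_gegTail, sub_div, Finset.sum_div]
    congr 1
    exact Finset.sum_congr rfl fun n _ => by ring
  rw [norm_sub_rev, ← e]
  refine norm_tsum_div_le (by linarith) (fun l hl => gegTail_eq_zero k _ (hl.trans_le hK)) h0 h1.le
    ?_ ?_ fun x hx => norm_tsum_gegTail_le k hK hv hx.1 (hx.2.trans_lt h1)
  · refine (summable_pow_mul_gegTail k K hv h0 h1).norm.congr fun l => ?_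
    rw [norm_mul, norm_pow, Complex.norm_real, Real.norm_of_nonneg h0, mul_comm]
  · have := fun n => (halfBinom_pos k n).le
    exact mul_nonneg (by positivity) (tsum_nonneg fun n => mul_nonneg (this _)
      (pow_nonneg hv.1.le _))

/-- The Abel means `∑ (-h)ˡ (l + k choose k) / (l + s)`. -/
noncomputable def chooseSum (k : ℕ) (s : ℂ) (h : ℝ) : ℂ :=
  ∑' l : ℕ, (-(h : ℂ)) ^ l * ((l + k).choose k : ℂ) / (l + s)

lemma hasSum_neg_pow_mul_choose (k : ℕ) {h : ℝ} (h0 : 0 ≤ h) (h1 : h < 1) :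
    HasSum (fun l : ℕ => (-(h : ℂ)) ^ l * ((l + k).choose k : ℂ)) (1 / (1 + h) ^ (k + 1)) := by
  simpa using hasSum_pow_mul_choose k 0 (norm_neg_ofReal_lt_one h0 h1)

lemma hasSum_chooseSum (k : ℕ) (s : ℂ) {h : ℝ} (h0 : 0 ≤ h) (h1 : h < 1) :
    HasSum (fun l : ℕ => (-(h : ℂ)) ^ l * ((l + k).choose k : ℂ) / (l + s)) (chooseSum k s h) :=
  (summable_div_natCast_add (hasSum_neg_pow_mul_choose k h0 h1).summable s).hasSum

lemma natCast_add_ne_zero {s : ℂ} (hs : s ∈ Complex.integerComplement) (l : ℕ) :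
    (l : ℂ) + s ≠ 0 := by
  simpa [add_comm] using Complex.integerComplement_add_ne_zero hs l

lemma natCast_add_one_sub_mem_integerComplement {s : ℂ} (hs : s ∈ Complex.integerComplement)
    (k : ℕ) : (k + 1 - s : ℂ) ∈ Complex.integerComplement := by
  rintro ⟨a, ha⟩
  exact hs ⟨k + 1 - a, by push_cast; rw [ha]; ring⟩

lemma chooseSum_succ (k : ℕ) {s : ℂ} (hs : s ∈ Complex.integerComplement) {h : ℝ} (h0 : 0 ≤ h)
    (h1 : h < 1) : ((k : ℂ) + 1) * chooseSum (k + 1) s h =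
      1 / (1 + h) ^ (k + 1) + (k + 1 - s) * chooseSum k s h := by
  refine ((hasSum_chooseSum (k + 1) s h0 h1).mul_left _).unique
    (((hasSum_neg_pow_mul_choose k h0 h1).add
      ((hasSum_chooseSum k s h0 h1).mul_left _)).congr_fun fun l => ?_)
  have hl := natCast_add_ne_zero hs l
  have hc : (((l + k).choose k : ℕ) : ℂ) * (l + k + 1) =
      ((l + (k + 1)).choose (k + 1) : ℕ) * (k + 1) := by
    have := Nat.add_one_mul_choose_eq (l + k) k
    rw [mul_comm]
    exact_mod_cast this
  field_simp
  linear_combination (-(-(h : ℂ)) ^ l) * hc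

lemma mul_chooseSum_succ_reflect (k : ℕ) {s : ℂ} (hs : s ∈ Complex.integerComplement) {h : ℝ}
    (h0 : 0 ≤ h) (h1 : h < 1) : ((k : ℂ) + 1) * (h * chooseSum (k + 1) (k + 2 - s) h) =
      -(1 / (1 + h) ^ (k + 1)) + (k + 1 - s) * chooseSum k (k + 1 - s) h := by
  have hA := (((hasSum_neg_pow_mul_choose k h0 h1).neg).add
      ((hasSum_chooseSum k (k + 1 - s) h0 h1).mul_left (k + 1 - s)))
  have hs' := natCast_add_one_sub_mem_integerComplement hs k
  have hB := (hasSum_nat_add_iff' 1).2 hA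
  have h00 := natCast_add_ne_zero hs' 0
  simp only [Nat.cast_zero, zero_add] at h00
  rw [Finset.sum_range_one] at hB
  have e0 : -((-(h : ℂ)) ^ 0 * ((0 + k).choose k : ℂ)) +
      (k + 1 - s) * ((-(h : ℂ)) ^ 0 * ((0 + k).choose k : ℂ) / ((0 : ℕ) + (k + 1 - s))) = 0 := by
    simp
    field_simp
    ring
  rw [e0, sub_zero] at hB
  refine (((hasSum_chooseSum (k + 1) (k + 2 - s) h0 h1).mul_left (h : ℂ)).mul_left _).unique
    (hB.congr_fun fun l => ?_)
  have hl := natCast_add_ne_zero hs' (l + 1)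
  rw [show (l : ℂ) + (k + 2 - s) = ((l + 1 : ℕ) : ℂ) + (k + 1 - s) by push_cast; ring]
  have hc : (((l + 1 + k).choose (k + 1) : ℕ) : ℂ) * (k + 1) =
      ((l + 1 + k).choose k : ℕ) * (l + 1) := by
    have := Nat.choose_succ_right_eq (l + 1 + k) k
    rw [show l + 1 + k - k = l + 1 by omega] at this
    exact_mod_cast this
  rw [show l + (k + 1) = l + 1 + k by omega]
  field_simp
  push_cast
  rw [pow_succ]
  linear_combination (h * (-(h : ℂ)) ^ l) * hc

lemma eventually_mem_Ioo : ∀ᶠ h : ℝ in 𝓝[<] 1, h ∈ Set.Ioo (0 : ℝ) 1 := Ioo_mem_nhdsLT one_pos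

lemma one_sub_mul_pow_le {h : ℝ} (h0 : 0 ≤ h) (h1 : h ≤ 1) (l : ℕ) :
    (1 - h) * h ^ l ≤ 1 / (l + 1) := by
  rw [le_div_iff₀ (by positivity)]
  have e : ∑ i ∈ range (l + 1), h ^ l ≤ ∑ i ∈ range (l + 1), h ^ i :=
    Finset.sum_le_sum fun i hi => pow_le_pow_of_le_one h0 h1 (by have := mem_range.1 hi; omega)
  simp at e
  have := mul_neg_geom_sum h (l + 1)
  nlinarith [mul_le_mul_of_nonneg_left e (sub_nonneg.2 h1), pow_nonneg h0 (l + 1)]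

lemma summable_inv_mul_inv_natCast_add (s : ℂ) :
    Summable fun l : ℕ => 1 / ((l : ℝ) + 1) * ‖((l : ℂ) + s)⁻¹‖ := by
  have hs : Summable fun l : ℕ => 1 / ((l : ℝ) + 1) ^ 2 := by
    simpa using (summable_nat_add_iff 1).2 (Real.summable_one_div_nat_pow.2 one_lt_two)
  refine summable_of_isBigO_nat hs (Asymptotics.IsBigO.of_bound 2 ?_)
  filter_upwards [eventually_ge_atTop ⌈2 * ‖s‖ + 1⌉₊] with l hl
  have hl : 2 * ‖s‖ + 1 ≤ l := (Nat.le_ceil _).trans (by exact_mod_cast hl)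
  have h1 := norm_sub_le ((l : ℂ) + s) s
  simp only [add_sub_cancel_right, Complex.norm_natCast] at h1
  have h2 : ((l : ℝ) + 1) / 2 ≤ ‖(l : ℂ) + s‖ := by linarith [norm_nonneg s]
  have hp : 0 < (l : ℝ) + 1 := by positivity
  rw [norm_mul, norm_norm, norm_inv, Real.norm_of_nonneg (by positivity),
    Real.norm_of_nonneg (by positivity)]
  calc 1 / ((l : ℝ) + 1) * ‖(l : ℂ) + s‖⁻¹ ≤ 1 / ((l : ℝ) + 1) * (((l : ℝ) + 1) / 2)⁻¹ := by gcongr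
    _ = _ := by field_simp

lemma tendsto_one_sub : Tendsto (fun h : ℝ => 1 - (h : ℂ)) (𝓝[<] 1) (𝓝 0) := by
  refine (Continuous.tendsto' (by fun_prop) _ _ ?_).mono_left nhdsWithin_le_nhds
  simp

lemma tendsto_one_div_one_add_pow (n : ℕ) :
    Tendsto (fun h : ℝ => 1 / (1 + (h : ℂ)) ^ n) (𝓝[<] 1) (𝓝 (1 / (1 + (1 : ℝ)) ^ n)) := by
  refine ContinuousAt.tendsto ?_ |>.mono_left nhdsWithin_le_nhds
  have : (1 + ((1 : ℝ) : ℂ)) ^ n ≠ 0 := pow_ne_zero _ (by norm_num)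
  fun_prop (disch := assumption)

lemma tendsto_one_sub_mul_chooseSum (k : ℕ) {s : ℂ} (hs : s ∈ Complex.integerComplement) :
    Tendsto (fun h : ℝ => (1 - (h : ℂ)) * chooseSum k s h) (𝓝[<] 1) (𝓝 0) := by
  induction k with
  | zero =>
    have key := tendsto_tsum_of_dominated_convergence (𝓕 := 𝓝[<] (1 : ℝ))
      (f := fun (h : ℝ) (l : ℕ) => (1 - (h : ℂ)) * ((-(h : ℂ)) ^ l / (l + s)))
      (g := fun _ => 0) (summable_inv_mul_inv_natCast_add s) (fun l => ?_) ?_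
    · simp only [tsum_zero] at key
      refine key.congr fun h => ?_
      rw [tsum_mul_left]
      simp [chooseSum]
    · have : Tendsto (fun h : ℝ => (-(h : ℂ)) ^ l / (l + s)) (𝓝[<] 1)
          (𝓝 ((-((1 : ℝ) : ℂ)) ^ l / (l + s))) :=
        (Continuous.tendsto (by fun_prop) _).mono_left nhdsWithin_le_nhds
      simpa using tendsto_one_sub.mul this
    · filter_upwards [eventually_mem_Ioo] with h hh l
      have e : (1 : ℂ) - h = ((1 - h : ℝ) : ℂ) := by push_cast; ring
      rw [e, div_eq_mul_inv, ← mul_assoc, norm_mul, norm_mul, norm_pow, norm_neg,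
        Complex.norm_real, Complex.norm_real, Real.norm_of_nonneg hh.1.le,
        Real.norm_of_nonneg (sub_nonneg.2 hh.2.le)]
      gcongr
      exact one_sub_mul_pow_le hh.1.le hh.2.le l
  | succ k ih =>
    have hk : (k : ℂ) + 1 ≠ 0 := by exact_mod_cast k.succ_ne_zero
    have := ((tendsto_one_sub.mul (tendsto_one_div_one_add_pow (k + 1))).add
      (ih.const_mul (k + 1 - s))).div_const ((k : ℂ) + 1)
    simp only [zero_mul, mul_zero, add_zero, zero_div] at this
    refine this.congr' ?_
    filter_upwards [eventually_mem_Ioo] with h hh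
    have := chooseSum_succ k hs hh.1.le hh.2
    field_simp at this ⊢
    linear_combination (-(1 - (h : ℂ))) * this

lemma half_mem_integerComplement {s : ℂ} (hs : s ∈ Complex.integerComplement) :
    s / 2 ∈ Complex.integerComplement := by
  rintro ⟨a, ha⟩
  exact hs ⟨2 * a, by push_cast; rw [ha]; ring⟩

lemma hasSum_cotTerm {s : ℂ} (hs : s ∈ Complex.integerComplement) :
    HasSum (cotTerm s) (Real.pi * Complex.cot (Real.pi * s) - 1 / s) := by
  rw [cot_series_rep' hs]
  exact (summable_cotTerm hs).hasSum

/-- Partial fraction expansion of the cosecant. -/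
lemma hasSum_neg_one_pow_mul_cotTerm {s : ℂ} (hs : s ∈ Complex.integerComplement) :
    HasSum (fun n : ℕ => (-1) ^ (n + 1) * cotTerm s n)
      (Real.pi / Complex.sin (Real.pi * s) - 1 / s) := by
  have h1 := hasSum_cotTerm hs
  have hodd : HasSum (fun n : ℕ => cotTerm s (2 * n + 1))
      ((Real.pi * Complex.cot (Real.pi * (s / 2)) - 1 / (s / 2)) / 2) := by
    refine ((hasSum_cotTerm (half_mem_integerComplement hs)).div_const 2).congr_fun fun n => ?_
    simp only [cotTerm]
    push_cast
    rw [show s - (2 * n + 1 + 1) = 2 * (s / 2 - (n + 1)) by ring,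
      show s + (2 * n + 1 + 1) = 2 * (s / 2 + (n + 1)) by ring]
    simp only [one_div, mul_inv]
    ring
  have heven : Summable fun n : ℕ => cotTerm s (2 * n) :=
    h1.summable.comp_injective (fun a b h => by simpa using h)
  have hsum := (heven.hasSum.even_add_odd hodd).unique h1
  have hp : HasSum (fun n : ℕ => (-1) ^ (n + 1) * cotTerm s n)
      (-(∑' n : ℕ, cotTerm s (2 * n)) +
        (Real.pi * Complex.cot (Real.pi * (s / 2)) - 1 / (s / 2)) / 2) := by
    refine HasSum.even_add_odd (heven.hasSum.neg.congr_fun fun n => ?_)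
      (hodd.congr_fun fun n => ?_)
    · simp [pow_succ]
    · simp [pow_succ]
  convert hp using 1
  rw [eq_sub_of_add_eq hsum]
  have hsin2 := sin_pi_mul_ne_zero (half_mem_integerComplement hs)
  have hsin := sin_pi_mul_ne_zero hs
  have e : (Real.pi : ℂ) / Complex.sin (Real.pi * s) = Real.pi * Complex.cot (Real.pi * (s / 2)) -
      Real.pi * Complex.cot (Real.pi * s) := by
    have e1 : (Real.pi : ℂ) * s = 2 * (Real.pi * (s / 2)) := by ring
    rw [Complex.cot, Complex.cot]
    have hs2 := Complex.sin_two_mul (Real.pi * (s / 2))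
    have hc2 := Complex.cos_two_mul' (Real.pi * (s / 2))
    rw [← e1] at hs2 hc2
    have hone := Complex.sin_sq_add_cos_sq (Real.pi * (s / 2))
    generalize Complex.sin (Real.pi * (s / 2)) = a at *
    generalize Complex.cos (Real.pi * (s / 2)) = b at *
    field_simp
    rw [hs2, hc2]
    linear_combination (-a) * hone
  rw [e]
  have := Complex.integerComplement.ne_zero hs
  field_simp
  ring

lemma tendsto_chooseSum_zero {s : ℂ} (hs : s ∈ Complex.integerComplement) :
    Tendsto (fun h : ℝ => chooseSum 0 s h + h * chooseSum 0 (1 - s) h) (𝓝[<] 1)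
      (𝓝 (Real.pi / Complex.sin (Real.pi * s))) := by
  have hC := hasSum_neg_one_pow_mul_cotTerm hs
  have key := tendsto_tsum_of_dominated_convergence (𝓕 := 𝓝[<] (1 : ℝ))
    (f := fun (h : ℝ) (n : ℕ) => (-(h : ℂ)) ^ (n + 1) * cotTerm s n)
    (g := fun n => (-1) ^ (n + 1) * cotTerm s n) (summable_cotTerm hs).norm (fun n => ?_) ?_
  · rw [hC.tsum_eq] at key
    have := key.const_add (1 / s)
    rw [add_sub_cancel] at this
    refine this.congr' ?_
    filter_upwards [eventually_mem_Ioo] with h hh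
    have a1 := hasSum_chooseSum 0 s hh.1.le hh.2
    have a2 := (hasSum_chooseSum 0 (1 - s) hh.1.le hh.2).mul_left (h : ℂ)
    have a3 := ((hasSum_nat_add_iff' 1).2 a1).add a2
    rw [Finset.sum_range_one] at a3
    have a4 : HasSum (fun n : ℕ => (-(h : ℂ)) ^ (n + 1) * cotTerm s n)
        (chooseSum 0 s h - (-(h : ℂ)) ^ 0 * ((0 + 0).choose 0 : ℕ) / ((0 : ℕ) + s) +
          h * chooseSum 0 (1 - s) h) := by
      refine a3.congr_fun fun n => ?_
      have e1 : s - (n + 1) ≠ 0 := by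
        simpa [sub_eq_add_neg] using Complex.integerComplement_add_ne_zero hs (-(n + 1) : ℤ)
      have e2 : (n : ℂ) + 1 + s ≠ 0 := by simpa using natCast_add_ne_zero hs (n + 1)
      have e3 : (n : ℂ) + (1 - s) = -(s - (n + 1)) := by ring
      simp only [cotTerm, Nat.add_zero, Nat.choose_zero_right, Nat.cast_one, mul_one, Nat.cast_add]
      rw [e3, show s + (n + 1) = n + 1 + s by ring, pow_succ, div_neg]
      ring
    rw [a4.tsum_eq]
    simp
    ring
  · have : Tendsto (fun h : ℝ => (-(h : ℂ)) ^ (n + 1)) (𝓝[<] 1) (𝓝 ((-1) ^ (n + 1))) :=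
      (Continuous.tendsto' (by fun_prop) _ _ (by simp)).mono_left nhdsWithin_le_nhds
    exact this.mul_const _
  · filter_upwards [eventually_mem_Ioo] with h hh n
    rw [norm_mul, norm_pow]
    exact mul_le_of_le_one_left (norm_nonneg _)
      (pow_le_one₀ (norm_nonneg _) (norm_neg_ofReal_lt_one hh.1.le hh.2).le)

lemma tendsto_chooseSum_add_chooseSum (k : ℕ) {s : ℂ} (hs : s ∈ Complex.integerComplement) :
    Tendsto (fun h : ℝ => chooseSum k s h + chooseSum k (k + 1 - s) h) (𝓝[<] 1)
      (𝓝 (Complex.Gamma s * Complex.Gamma (k + 1 - s) / Complex.Gamma (k + 1))) := by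
  have hm := natCast_add_one_sub_mem_integerComplement hs
  induction k with
  | zero =>
    have := (tendsto_chooseSum_zero hs).add
      (tendsto_one_sub_mul_chooseSum 0 (hm 0))
    simp only [Nat.cast_zero, zero_add, Complex.Gamma_one, div_one, add_zero] at this ⊢
    rw [Complex.Gamma_mul_Gamma_one_sub]
    refine this.congr fun h => by ring
  | succ k ih =>
    have hk : (k : ℂ) + 1 ≠ 0 := by exact_mod_cast k.succ_ne_zero
    have := (ih.const_mul ((k + 1 - s) / (k + 1))).add
      (tendsto_one_sub_mul_chooseSum (k + 1) (hm (k + 1)))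
    convert this.congr' ?_ using 2
    · have h1 := Complex.Gamma_add_one _ (Complex.integerComplement.ne_zero (hm k))
      have h2 := Complex.Gamma_add_one _ hk
      push_cast
      rw [h2, show (k : ℂ) + 1 + 1 - s = k + 1 - s + 1 by ring, h1]
      field_simp
      ring
    · filter_upwards [eventually_mem_Ioo] with h hh
      have h1 := chooseSum_succ k hs hh.1.le hh.2
      have h2 := mul_chooseSum_succ_reflect k hs hh.1.le hh.2
      push_cast
      rw [show (k : ℂ) + 1 + 1 - s = k + 2 - s by ring]
      field_simp
      linear_combination -h1 - h2

lemma summable_of_succ_le {x q : ℕ → ℝ} {θ : ℝ} (hθ : θ < 1) (hx : ∀ n, 0 ≤ x n)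
    (hq0 : ∀ n, 0 ≤ q n) (hq : Summable q) (h : ∀ᶠ n in atTop, x (n + 1) ≤ θ * x n + q n) :
    Summable x := by
  obtain ⟨N, hN⟩ := eventually_atTop.1 h
  refine (summable_nat_add_iff N).1 (summable_of_sum_range_le
    (c := (x N + ∑' n, q (n + N)) / (1 - θ)) (fun n => hx _) fun n => ?_)
  have hqN := (summable_nat_add_iff N).2 hq
  have h1 : ∑ i ∈ range n, x (i + N) + x (n + N) =
      ∑ i ∈ range n, x (i + 1 + N) + x N := by
    rw [← Finset.sum_range_succ (fun i => x (i + N)), Finset.sum_range_succ']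
    simp
  have h2 : ∑ i ∈ range n, x (i + 1 + N) ≤
      θ * ∑ i ∈ range n, x (i + N) + ∑ i ∈ range n, q (i + N) := by
    rw [Finset.mul_sum, ← Finset.sum_add_distrib]
    refine Finset.sum_le_sum fun i _ => ?_
    rw [show i + 1 + N = i + N + 1 by omega]
    exact hN _ (by omega)
  have h3 := hqN.sum_le_tsum (range n) (fun i _ => hq0 _)
  rw [le_div_iff₀ (by linarith)]
  linarith [hx (n + N)]

lemma exists_summable_majorant {c q : ℕ → ℝ} {θ C : ℝ} (hθ : θ < 1) (hC : 0 ≤ C)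
    (hc0 : ∀ n, 0 ≤ c n) (hc : Tendsto c atTop (𝓝 θ)) (hq0 : ∀ n, 0 ≤ q n) (hq : Summable q) :
    ∃ A : ℕ → ℝ, A 0 = C ∧ (∀ n, A (n + 1) = c n * A n + q n) ∧ Summable A := by
  set A : ℕ → ℝ := fun n => Nat.rec C (fun n x => c n * x + q n) n with hA
  have hs : ∀ n, A (n + 1) = c n * A n + q n := fun n => rfl
  have hA0 : ∀ n, 0 ≤ A n := by
    intro n
    induction n with
    | zero => exact hC
    | succ n ih =>
      rw [hs]
      exact add_nonneg (mul_nonneg (hc0 n) ih) (hq0 n)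
  refine ⟨A, rfl, hs, ?_⟩
  obtain ⟨θ', h1, h2⟩ := exists_between hθ
  refine summable_of_succ_le h2 hA0 hq0 hq ?_
  filter_upwards [hc.eventually_le_const h1] with n hn
  rw [hs]
  have := hA0 n
  gcongr

lemma choose_mul_two_mul_add (k l n : ℕ) :
    (2 * (l : ℂ) + (k + 1)) * ((l + n + k).choose (k + 2 * n) : ℕ) =
      (k + 1 + 2 * n) * (((l + n + (k + 1)).choose (k + 1 + 2 * n) : ℕ) +
        ((l + n + k).choose (k + 1 + 2 * n) : ℕ)) := by
  have a1 := Nat.add_one_mul_choose_eq (l + n + k) (k + 2 * n)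
  have a1 := congrArg (Nat.cast : ℕ → ℂ) a1
  push_cast at a1
  have a2 := choose_succ_mul k l n
  rw [show l + n + (k + 1) = l + n + k + 1 by omega,
    show k + 1 + 2 * n = k + 2 * n + 1 by omega]
  linear_combination a1 - a2

lemma hasSum_pow_mul_two_mul_add_mul_gegCoeff (k n : ℕ) {y : ℂ} (hy : ‖y‖ < 1) :
    HasSum (fun l : ℕ => y ^ l * (2 * (l : ℂ) + (k + 1)) * gegCoeff k l n)
      ((-4) ^ n * halfBinom k n * (k + 1 + 2 * n) *
        (y ^ n * (1 + y) / (1 - y) ^ (k + 2 * n + 2))) := by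
  have h1 := hasSum_pow_mul_choose (k + 1) n hy
  have h2 : HasSum (fun l : ℕ => y ^ l * ((l + n + k).choose (k + 1 + 2 * n) : ℂ))
      (y * (y ^ n / (1 - y) ^ (k + 1 + 2 * n + 1))) := by
    refine (hasSum_nat_add_iff' 1).1 ?_
    rw [Finset.sum_range_one, Nat.choose_eq_zero_of_lt (by omega)]
    simp only [Nat.cast_zero, mul_zero, sub_zero]
    refine (h1.mul_left y).congr_fun fun l => ?_
    rw [show l + 1 + n + k = l + n + (k + 1) by omega]
    ring
  have h3 := (h1.add h2).mul_left ((-4) ^ n * (halfBinom k n : ℂ) * (k + 1 + 2 * n))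
  rw [show k + 1 + 2 * n + 1 = k + 2 * n + 2 by omega] at h3
  rw [show y ^ n * (1 + y) / (1 - y) ^ (k + 2 * n + 2) = y ^ n / (1 - y) ^ (k + 2 * n + 2) +
    y * (y ^ n / (1 - y) ^ (k + 2 * n + 2)) by ring]
  refine h3.congr_fun fun l => ?_
  rw [gegCoeff]
  linear_combination (y ^ l * (-4) ^ n * halfBinom k n) * choose_mul_two_mul_add k l n

/-- The weight `(2l + D - 2) / (ν(ν + D - 2) - l(l + D - 2))`, for `D = k + 3`. -/
noncomputable def weight (k : ℕ) (ν : ℂ) (l : ℕ) : ℂ :=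
  (2 * (l : ℂ) + (k + 1)) / (ν * (ν + (k + 1)) - l * ((l : ℂ) + (k + 1)))

lemma weight_denom_ne_zero (k : ℕ) {ν : ℂ} (hν : ν ∈ Complex.integerComplement) (l : ℕ) :
    ν * (ν + (k + 1)) - l * ((l : ℂ) + (k + 1)) ≠ 0 := by
  have h1 : ν - l ≠ 0 := by
    simpa [sub_eq_add_neg] using Complex.integerComplement_add_ne_zero hν (-l : ℤ)
  have h2 : ν + (l + k + 1) ≠ 0 := by
    simpa using Complex.integerComplement_add_ne_zero hν (l + k + 1 : ℤ)
  rw [show ν * (ν + (k + 1)) - l * ((l : ℂ) + (k + 1)) = (ν - l) * (ν + (l + k + 1)) by ring]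
  exact mul_ne_zero h1 h2

lemma mul_weight (k : ℕ) {ν : ℂ} (hν : ν ∈ Complex.integerComplement) (x : ℂ) (l : ℕ) :
    x * weight k ν l = -(x / (l + -ν) + x / (l + (ν + (k + 1)))) := by
  have hd := weight_denom_ne_zero k hν l
  have e : ν * (ν + (k + 1)) - l * ((l : ℂ) + (k + 1)) =
    -((l + -ν) * (l + (ν + (k + 1)))) := by ring
  rw [weight]
  rw [e] at hd ⊢
  have h1 := left_ne_zero_of_mul (neg_ne_zero.1 hd)
  have h2 := right_ne_zero_of_mul (neg_ne_zero.1 hd)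
  generalize hA : (l : ℂ) + -ν = A at *
  generalize hB : (l : ℂ) + (ν + (k + 1)) = B at *
  field_simp
  rw [← hA, ← hB]
  ring

lemma summable_mul_weight (k : ℕ) {ν : ℂ} (hν : ν ∈ Complex.integerComplement) {a : ℕ → ℂ}
    (ha : Summable a) : Summable fun l => a l * weight k ν l := by
  simp_rw [mul_weight k hν]
  exact ((summable_div_natCast_add ha _).add (summable_div_natCast_add ha _)).neg

lemma tsum_mul_weight (k : ℕ) {ν : ℂ} (hν : ν ∈ Complex.integerComplement) {a : ℕ → ℂ}
    (ha : Summable a) : ∑' l, a l * weight k ν l =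
      -(∑' l : ℕ, a l / (l + -ν) + ∑' l : ℕ, a l / (l + (ν + (k + 1)))) := by
  simp_rw [mul_weight k hν]
  rw [tsum_neg, (summable_div_natCast_add ha _).tsum_add (summable_div_natCast_add ha _)]

/-- The coefficient of `tⁿ` in `∑ (-h)ˡ C_l^λ(1 - 2t) weight_l`. -/
noncomputable def dougallCoeff (k : ℕ) (ν : ℂ) (n : ℕ) (h : ℝ) : ℂ :=
  ∑' l : ℕ, (-(h : ℂ)) ^ l * gegCoeff k l n * weight k ν l

lemma tendsto_sum_dougallCoeff (k : ℕ) {ν : ℂ} (hν : ν ∈ Complex.integerComplement) {t : ℝ}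
    (ht : t ∈ Set.Ioo (0 : ℝ) 1) {h : ℝ} (h0 : 0 ≤ h) (h1 : h < 1) :
    Tendsto (fun K => ∑ n ∈ range K, dougallCoeff k ν n h * (t : ℂ) ^ n) atTop
      (𝓝 (∑' l : ℕ, (-(h : ℂ)) ^ l * geg k l t * weight k ν l)) := by
  rw [tsum_mul_weight k hν (summable_pow_mul_geg k ht h0 h1)]
  refine ((tendsto_sum_gegCoeff_div k ht h0 h1 _).add
    (tendsto_sum_gegCoeff_div k ht h0 h1 _)).neg.congr fun K => ?_
  rw [← Finset.sum_add_distrib, ← Finset.sum_neg_distrib]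
  refine Finset.sum_congr rfl fun n _ => ?_
  rw [dougallCoeff, tsum_mul_weight k hν (summable_pow_mul_gegCoeff k n h0 h1)]
  ring

lemma dougallCoeff_succ (k n : ℕ) {ν : ℂ} (hν : ν ∈ Complex.integerComplement) {h : ℝ}
    (h0 : 0 ≤ h) (h1 : h < 1) :
    ((n : ℂ) + 1) * (n + (k + 2) / 2) * dougallCoeff k ν (n + 1) h =
      (n - ν) * (n + ν + (k + 1)) * dougallCoeff k ν n h +
        (-4) ^ n * halfBinom k n * (k + 1 + 2 * n) *
          ((-(h : ℂ)) ^ n * (1 - h) / (1 + h) ^ (k + 2 * n + 2)) := by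
  have hs := fun n => (summable_mul_weight k hν (summable_pow_mul_gegCoeff k n h0 h1)).hasSum
  have hr := hasSum_pow_mul_two_mul_add_mul_gegCoeff k n (norm_neg_ofReal_lt_one h0 h1)
  rw [sub_neg_eq_add, ← sub_eq_add_neg] at hr
  refine ((hs (n + 1)).mul_left _).unique ((((hs n).mul_left _).add hr).congr_fun fun l => ?_)
  have hg := gegCoeff_succ k l n
  have hw : weight k ν l * (ν * (ν + (k + 1)) - l * ((l : ℂ) + (k + 1))) =
      2 * (l : ℂ) + (k + 1) := div_mul_cancel₀ _ (weight_denom_ne_zero k hν l)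
  linear_combination ((-(h : ℂ)) ^ l * weight k ν l) * hg + ((-(h : ℂ)) ^ l * gegCoeff k l n) * hw

lemma norm_dougallCoeff_remainder_le (k n : ℕ) {h : ℝ} (h0 : 0 ≤ h) (h1 : h < 1) :
    ‖(-4) ^ n * (halfBinom k n : ℂ) * (k + 1 + 2 * n) *
      ((-(h : ℂ)) ^ n * (1 - h) / (1 + h) ^ (k + 2 * n + 2))‖ ≤
        halfBinom k n * (k + 1 + 2 * n) * (1 - h) := by
  have hb := halfBinom_pos k n
  have e : (-4) ^ n * (halfBinom k n : ℂ) * (k + 1 + 2 * n) *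
      ((-(h : ℂ)) ^ n * (1 - h) / (1 + h) ^ (k + 2 * n + 2)) =
      ((halfBinom k n * (k + 1 + 2 * n) * (1 - h) *
        ((4 * h) ^ n / (1 + h) ^ (k + 2 * n + 2)) : ℝ) : ℂ) := by
    push_cast
    rw [neg_pow (4 : ℂ), neg_pow (h : ℂ), mul_pow]
    have : ((-1 : ℂ) ^ n) * (-1) ^ n = 1 := by rw [← mul_pow]; simp
    linear_combination (4 ^ n * (halfBinom k n : ℂ) * (k + 1 + 2 * n) *
      (h ^ n * (1 - h) / (1 + h) ^ (k + 2 * n + 2))) * this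
  have h1' : 0 ≤ 1 - h := by linarith
  rw [e, Complex.norm_real, Real.norm_of_nonneg (by positivity)]
  refine mul_le_of_le_one_right (by positivity) ?_
  rw [div_le_one (by positivity)]
  calc (4 * h) ^ n ≤ ((1 + h) ^ 2) ^ n := by
        gcongr
        nlinarith [sq_nonneg (1 - h)]
    _ = (1 + h) ^ (2 * n) := by rw [pow_mul]
    _ ≤ (1 + h) ^ (k + 2 * n + 2) := pow_le_pow_right₀ (by linarith) (by omega)

lemma tendsto_dougallCoeff_zero (k : ℕ) {ν : ℂ} (hν : ν ∈ Complex.integerComplement) :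
    Tendsto (dougallCoeff k ν 0) (𝓝[<] 1)
      (𝓝 (-(Complex.Gamma (-ν) * Complex.Gamma (ν + (k + 1)) / Complex.Gamma (k + 1)))) := by
  have hν' : -ν ∈ Complex.integerComplement := by
    rintro ⟨a, ha⟩
    exact hν ⟨-a, by push_cast; rw [ha]; ring⟩
  have := (tendsto_chooseSum_add_chooseSum k hν').neg
  rw [show (k : ℂ) + 1 - -ν = ν + (k + 1) by ring] at this
  refine this.congr' ?_
  filter_upwards [eventually_mem_Ioo] with h hh
  rw [dougallCoeff, tsum_mul_weight k hν (summable_pow_mul_gegCoeff k 0 hh.1.le hh.2)]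
  simp [chooseSum, gegCoeff, halfBinom_zero]

lemma natCast_add_one_ne_zero (n : ℕ) : (n : ℂ) + 1 ≠ 0 := by exact_mod_cast n.succ_ne_zero

lemma natCast_add_half_ne_zero (k n : ℕ) : (n : ℂ) + (k + 2) / 2 ≠ 0 := by
  intro h
  have h := congrArg Complex.re h
  have : ((k : ℂ) + 2) / 2 = ((((k : ℝ) + 2) / 2 : ℝ) : ℂ) := by push_cast; ring
  rw [this] at h
  simp only [Complex.add_re, Complex.natCast_re, Complex.ofReal_re, Complex.zero_re] at h
  have : 0 ≤ (n : ℝ) := n.cast_nonneg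
  have : 0 ≤ (k : ℝ) := k.cast_nonneg
  linarith

/-- The ratio of consecutive coefficients of `₂F₁(-ν, ν + k + 1; (k + 2) / 2; ·)`. -/
noncomputable def hypRatio (k : ℕ) (ν : ℂ) (n : ℕ) : ℂ :=
  (n - ν) * (n + ν + (k + 1)) / ((n + 1) * (n + (k + 2) / 2))

lemma tendsto_hypRatio (k : ℕ) (ν : ℂ) : Tendsto (hypRatio k ν) atTop (𝓝 1) := by
  have h : ∀ s a : ℂ, (∀ n : ℕ, (n : ℂ) + a ≠ 0) →
      Tendsto (fun n : ℕ => ((n : ℂ) + s) / (n + a)) atTop (𝓝 1) := by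
    intro s a ha
    have := ((tendsto_inv_natCast_add a).const_mul (s - a)).const_add 1
    rw [mul_zero, add_zero] at this
    refine this.congr fun n => ?_
    have := ha n
    field_simp
    ring
  have := (h (-ν) 1 natCast_add_one_ne_zero).mul
    (h (ν + (k + 1)) ((k + 2) / 2) (natCast_add_half_ne_zero k))
  rw [one_mul] at this
  refine this.congr fun n => ?_
  rw [hypRatio, div_mul_div_comm, sub_eq_add_neg, add_assoc (n : ℂ) ν]

lemma poch_quotient_succ (k : ℕ) (ν : ℂ) (n : ℕ) :
    poch (-ν) (n + 1) * poch (ν + (k + 1)) (n + 1) /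
        (poch ((k + 2) / 2) (n + 1) * (n + 1).factorial) =
      hypRatio k ν n * (poch (-ν) n * poch (ν + (k + 1)) n /
        (poch ((k + 2) / 2) n * n.factorial)) := by
  rw [poch_succ, poch_succ, poch_succ, Nat.factorial_succ, hypRatio, div_mul_div_comm]
  push_cast
  congr 1 <;> ring

lemma norm_dougallCoeff_succ_sub_le (k n : ℕ) {ν : ℂ} (hν : ν ∈ Complex.integerComplement)
    {h : ℝ} (h0 : 0 ≤ h) (h1 : h < 1) :
    ‖dougallCoeff k ν (n + 1) h - hypRatio k ν n * dougallCoeff k ν n h‖ ≤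
      2 * halfBinom k n * (1 - h) := by
  have e1 := natCast_add_one_ne_zero n
  have e2 := natCast_add_half_ne_zero k n
  have hrec := dougallCoeff_succ k n hν h0 h1
  have hrem := norm_dougallCoeff_remainder_le k n h0 h1
  rw [← sub_eq_iff_eq_add'] at hrec
  rw [← hrec] at hrem
  have e : dougallCoeff k ν (n + 1) h - hypRatio k ν n * dougallCoeff k ν n h =
      (((n : ℂ) + 1) * (n + (k + 2) / 2) * dougallCoeff k ν (n + 1) h -
        (n - ν) * (n + ν + (k + 1)) * dougallCoeff k ν n h) /
          ((((n : ℝ) + 1) * (n + (k + 2) / 2) : ℝ) : ℂ) := by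
    rw [hypRatio]
    push_cast
    generalize (n : ℂ) + (k + 2) / 2 = c at e2 ⊢
    field_simp
  rw [e, norm_div, Complex.norm_real, Real.norm_of_nonneg (by positivity),
    div_le_iff₀ (by positivity)]
  refine hrem.trans ?_
  have hb := halfBinom_pos k n
  have h1' : 0 ≤ 1 - h := by linarith
  calc halfBinom k n * (k + 1 + 2 * n) * (1 - h)
      ≤ halfBinom k n * (2 * (1 * (n + (k + 2) / 2))) * (1 - h) := by
        gcongr
        linarith
    _ ≤ halfBinom k n * (2 * ((n + 1) * (n + (k + 2) / 2))) * (1 - h) := by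
        gcongr
        linarith [n.cast_nonneg (α := ℝ)]
    _ = _ := by ring

lemma tendsto_dougallCoeff (k n : ℕ) {ν : ℂ} (hν : ν ∈ Complex.integerComplement) :
    Tendsto (dougallCoeff k ν n) (𝓝[<] 1)
      (𝓝 (-(Complex.Gamma (-ν) * Complex.Gamma (ν + (k + 1)) / Complex.Gamma (k + 1)) *
        (poch (-ν) n * poch (ν + (k + 1)) n / (poch ((k + 2) / 2) n * n.factorial)))) := by
  induction n with
  | zero => simpa [poch_zero] using tendsto_dougallCoeff_zero k hν
  | succ n ih =>
    have hlim : Tendsto (fun h : ℝ => 2 * halfBinom k n * (1 - h)) (𝓝[<] 1) (𝓝 0) :=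
      (Continuous.tendsto' (by fun_prop) _ _ (by simp)).mono_left nhdsWithin_le_nhds
    have h0 : Tendsto (fun h => dougallCoeff k ν (n + 1) h - hypRatio k ν n * dougallCoeff k ν n h)
        (𝓝[<] 1) (𝓝 0) := by
      refine squeeze_zero_norm' ?_ hlim
      filter_upwards [eventually_mem_Ioo] with h hh
      exact norm_dougallCoeff_succ_sub_le k n hν hh.1.le hh.2
    have := h0.add (ih.const_mul (hypRatio k ν n))
    rw [poch_quotient_succ, mul_left_comm]
    simpa using this

lemma tendsto_tsum_weight (k : ℕ) {ν : ℂ} (hν : ν ∈ Complex.integerComplement) {t : ℝ}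
    (ht : t ∈ Set.Ioo (0 : ℝ) 1) :
    Tendsto (fun h : ℝ => ∑' l : ℕ, (-(h : ℂ)) ^ l * geg k l t * weight k ν l) (𝓝[<] 1)
      (𝓝 (-(Complex.Gamma (-ν) * Complex.Gamma (ν + (k + 1)) / Complex.Gamma (k + 1)) *
        F21 (-ν) (ν + (k + 1)) ((k + 2) / 2) t)) := by
  have ht0 := ht.1
  have hb := fun n => halfBinom_pos k n
  set L := -(Complex.Gamma (-ν) * Complex.Gamma (ν + (k + 1)) / Complex.Gamma (k + 1)) with hL
  have hc : Tendsto (fun n => t * ‖hypRatio k ν n‖) atTop (𝓝 t) := by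
    simpa using (tendsto_hypRatio k ν).norm.const_mul t
  have hL0 : Tendsto (dougallCoeff k ν 0) (𝓝[<] 1) (𝓝 L) := tendsto_dougallCoeff_zero k hν
  obtain ⟨A, hA0, hA, hAs⟩ := exists_summable_majorant (C := ‖L‖ + 1) ht.2 (by positivity)
    (fun n => by positivity) hc (q := fun n => 2 * (halfBinom k n * t ^ n))
    (fun n => by have := hb n; positivity) ((summable_halfBinom k ht.1.le ht.2).mul_left 2)
  have hbound : ∀ᶠ h : ℝ in 𝓝[<] 1, ∀ n, ‖dougallCoeff k ν n h * (t : ℂ) ^ n‖ ≤ A n := by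
    filter_upwards [eventually_mem_Ioo,
      hL0.norm.eventually_le_const (lt_add_one _)] with h hh h0 n
    induction n with
    | zero => simpa [hA0] using h0
    | succ n ih =>
      have hsub := norm_dougallCoeff_succ_sub_le k n hν hh.1.le hh.2
      have hle : ‖dougallCoeff k ν (n + 1) h‖ ≤
          ‖hypRatio k ν n‖ * ‖dougallCoeff k ν n h‖ + 2 * halfBinom k n := by
        have h1 := norm_le_insert' (dougallCoeff k ν (n + 1) h)
          (hypRatio k ν n * dougallCoeff k ν n h)
        rw [norm_mul] at h1
        have h2 : 2 * halfBinom k n * (1 - h) ≤ 2 * halfBinom k n :=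
          mul_le_of_le_one_right (by have := hb n; positivity) (by linarith [hh.1])
        linarith
      rw [norm_mul, norm_pow, Complex.norm_real, Real.norm_of_nonneg ht0.le] at ih ⊢
      rw [hA]
      calc ‖dougallCoeff k ν (n + 1) h‖ * t ^ (n + 1)
          ≤ (‖hypRatio k ν n‖ * ‖dougallCoeff k ν n h‖ + 2 * halfBinom k n) * t ^ (n + 1) := by
            gcongr
        _ = t * ‖hypRatio k ν n‖ * (‖dougallCoeff k ν n h‖ * t ^ n) +
            2 * (halfBinom k n * t ^ n) * t := by ring
        _ ≤ t * ‖hypRatio k ν n‖ * A n + 2 * (halfBinom k n * t ^ n) := by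
            have := hb n
            exact add_le_add (mul_le_mul_of_nonneg_left ih (by positivity))
              (mul_le_of_le_one_right (by positivity) ht.2.le)
  have hdom := tendsto_tsum_of_dominated_convergence hAs
    (g := fun n => L * (poch (-ν) n * poch (ν + (k + 1)) n /
      (poch ((k + 2) / 2) n * n.factorial) * (t : ℂ) ^ n)) (fun n => by
        rw [← mul_assoc]
        exact (tendsto_dougallCoeff k n hν).mul_const _) hbound
  rw [F21, ← tsum_mul_left]
  refine hdom.congr' ?_
  filter_upwards [eventually_mem_Ioo, hbound] with h hh hbd
  exact tendsto_nhds_unique (Summable.of_norm_bounded hAs hbd).hasSum.tendsto_sum_nat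
    (tendsto_sum_dougallCoeff k hν ht hh.1.le hh.2)

lemma gegCoeff_eq_poch (k l n : ℕ) :
    gegCoeff k l n = ((l + k).choose k : ℕ) * (poch (-l) n * poch (l + (k + 1)) n /
      (poch ((k + 2) / 2) n * n.factorial)) := by
  induction n with
  | zero => simp [gegCoeff, halfBinom_zero, poch_zero]
  | succ n ih =>
    have e1 := natCast_add_one_ne_zero n
    have e2 := natCast_add_half_ne_zero k n
    have h : gegCoeff k l (n + 1) = hypRatio k l n * gegCoeff k l n := by
      rw [hypRatio, div_mul_eq_mul_div, eq_div_iff (mul_ne_zero e1 e2), ← gegCoeff_succ]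
      ring
    rw [h, ih, poch_quotient_succ, mul_left_comm]

lemma legP_add_three (z ν : ℂ) (k : ℕ) :
    legP z ν (k + 3) = Complex.Gamma (ν + (k + 1)) /
      (Complex.Gamma (ν + 1) * Complex.Gamma (k + 1 + 1)) *
        F21 (-ν) (ν + (k + 1)) ((k + 2) / 2) ((1 - z) / 2) := by
  rw [legP]
  push_cast
  rw [show ν + ((k : ℂ) + 3) - 2 = ν + (k + 1) by ring,
    show (k : ℂ) + 3 - 1 = k + 1 + 1 by ring, show (k : ℂ) + 1 + 1 = k + 2 by ring]

lemma legP_natCast (z : ℂ) (k l : ℕ) :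
    legP z l (k + 3) = geg k l ((1 - z) / 2) / (k + 1) := by
  have hF : geg k l ((1 - z) / 2) =
      ((l + k).choose k : ℕ) * F21 (-l) (l + (k + 1)) ((k + 2) / 2) ((1 - z) / 2) := by
    rw [F21, ← (hasSum_geg k l _).tsum_eq, ← tsum_mul_left]
    simp_rw [gegCoeff_eq_poch, mul_assoc]
  have hc : (((l + k).choose k : ℕ) : ℂ) * k.factorial * l.factorial = (l + k).factorial := by
    have := Nat.add_choose_mul_factorial_mul_factorial l k
    rw [mul_right_comm]
    exact_mod_cast this
  have hk := natCast_add_one_ne_zero k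
  have hk' : (k.factorial : ℂ) ≠ 0 := by exact_mod_cast k.factorial_ne_zero
  have hl' : (l.factorial : ℂ) ≠ 0 := by exact_mod_cast l.factorial_ne_zero
  rw [legP_add_three, hF, Complex.Gamma_add_one _ hk, Complex.Gamma_nat_eq_factorial,
    Complex.Gamma_nat_eq_factorial, ← add_assoc, ← Nat.cast_add, Complex.Gamma_nat_eq_factorial,
    ← hc]
  field_simp

lemma dougall_term_eq (k : ℕ) (ν : ℂ) {z : ℝ} (hz : z ∈ Set.Ioo (-1 : ℝ) 1) (h : ℝ) (l : ℕ) :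
    (h : ℂ) ^ l * (2 * (l : ℂ) + (k + 3 : ℕ) - 2) * legP (z : ℂ) (l : ℂ) (k + 3) /
        (ν * (ν + (k + 3 : ℕ) - 2) - l * ((l : ℂ) + (k + 3 : ℕ) - 2)) =
      (-(h : ℂ)) ^ l * geg k l ((1 + z) / 2 : ℝ) * weight k ν l / (k + 1) := by
  have ht : (1 + z) / 2 ∈ Set.Ioo (0 : ℝ) 1 := ⟨by linarith [hz.1], by linarith [hz.2]⟩
  have hg := geg_one_sub k l ht
  rw [show ((1 - (1 + z) / 2 : ℝ) : ℂ) = (1 - z) / 2 by push_cast; ring] at hg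
  rw [legP_natCast, hg, weight, neg_pow (h : ℂ)]
  push_cast
  rw [show 2 * (l : ℂ) + (k + 3) - 2 = 2 * l + (k + 1) by ring,
    show ν + ((k : ℂ) + 3) - 2 = ν + (k + 1) by ring,
    show (l : ℂ) + (k + 3) - 2 = l + (k + 1) by ring]
  ring

/-- Abel-summed form of the generalized Dougall formula, valid in every dimension `D ≥ 3`:
for every `0 ≤ h < 1` the series `F(h) = Σ_l h^l (2l+D-2) P(z,l,D)/(ν(ν+D-2)-l(l+D-2))`
converges absolutely, and `F(h) → (π/sin(πν))·P(-z,ν,D)` as `h → 1⁻`. -/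
theorem stmt1 (D : ℕ) (hD : 3 ≤ D) (ν : ℂ) (hν : ∀ m : ℤ, ν ≠ m)
    (z : ℝ) (hz : z ∈ Set.Ioo (-1 : ℝ) 1) :
    (∀ h : ℝ, 0 ≤ h → h < 1 →
      Summable (fun l : ℕ => ‖(h : ℂ) ^ l * (2 * (l : ℂ) + D - 2) * legP (z : ℂ) (l : ℂ) D /
        (ν * (ν + D - 2) - l * ((l : ℂ) + D - 2))‖)) ∧
    Tendsto (fun h : ℝ => ∑' l : ℕ,
        (h : ℂ) ^ l * (2 * (l : ℂ) + D - 2) * legP (z : ℂ) (l : ℂ) D /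
          (ν * (ν + D - 2) - l * ((l : ℂ) + D - 2)))
      (nhdsWithin 1 (Set.Iio 1))
      (nhds ((Real.pi : ℂ) / Complex.sin (Real.pi * ν) * legP (-(z : ℂ)) ν D)) := by
  obtain ⟨k, rfl⟩ : ∃ k, D = k + 3 := ⟨D - 3, by omega⟩
  have hν' : ν ∈ Complex.integerComplement := fun ⟨a, ha⟩ => hν a ha.symm
  have ht : (1 + z) / 2 ∈ Set.Ioo (0 : ℝ) 1 := ⟨by linarith [hz.1], by linarith [hz.2]⟩
  simp_rw [dougall_term_eq k ν hz]
  refine ⟨fun h h0 h1 => ?_, ?_⟩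
  · exact ((summable_mul_weight k hν' (summable_pow_mul_geg k ht h0 h1)).div_const _).norm
  · simp_rw [tsum_div_const]
    convert (tendsto_tsum_weight k hν' ht).div_const ((k : ℂ) + 1) using 2
    have hk := natCast_add_one_ne_zero k
    have hsin := sin_pi_mul_ne_zero hν'
    have hΓ := Complex.Gamma_mul_Gamma_one_sub (-ν)
    rw [mul_neg, Complex.sin_neg, sub_neg_eq_add, add_comm 1 ν] at hΓ
    have hΓ0 : Complex.Gamma (ν + 1) ≠ 0 := Complex.Gamma_ne_zero fun m hm =>
      hν (-m - 1) (by push_cast; linear_combination hm)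
    have hΓk : Complex.Gamma (k + 1) ≠ 0 := by
      rw [Complex.Gamma_nat_eq_factorial]
      exact_mod_cast k.factorial_ne_zero
    rw [legP_add_three, Complex.Gamma_add_one _ hk, sub_neg_eq_add,
      show ((((1 + z) / 2 : ℝ)) : ℂ) = (1 + z) / 2 by push_cast; ring,
      eq_div_of_mul_eq hΓ0 hΓ]
    field_simp
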